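/- arXiv:1312.5192 — 2 statements merged into one kernel-verified Lean document; each statement's English description precedes it below -/
import Mathlib

section
/- Let (f^k)_{k≥0} be a sequence in ℝ^V with G(f^k) = 1 and S(f^k) ≠ 0 for all k, and let (c^k) be nonnegative reals with c^k ≥ γ for some γ > 0 and all k. Suppose G is strictly convex and that for each k there are subgradients r₂^k ∈ ∂R₂(f^k), s₁^k ∈ ∂S₁(f^k), g^k ∈ ∂G(f^k) such that f^{k+1} minimizes Φ_{f^k}^{c^k} over {u : G(u) ≤ 1} and Φ_{f^k}^{c^k}(f^{k+1}) < Φ_{f^k}^{c^k}(f^k). Then ‖f^{k+1} − f^k‖₂ → 0 as k → ∞. -/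
open Finset Filter

/-- Euclidean inner product on `V → ℝ`. -/
def ip {V : Type*} [Fintype V] (f g : V → ℝ) : ℝ := ∑ i, f i * g i

/-- Euclidean norm on `V → ℝ`. -/
noncomputable def nrm {V : Type*} [Fintype V] (f : V → ℝ) : ℝ :=
  Real.sqrt (∑ i, (f i) ^ 2)

/-- The subdifferential of `A` at `f`:  `a ∈ subdiff A f` iff
`A u ≥ A f + ⟨a, u - f⟩` for all `u`. -/
def subdiff {V : Type*} [Fintype V] (A : (V → ℝ) → ℝ) (f : V → ℝ) : Set (V → ℝ) :=
  {a | ∀ u, A f + ip a (u - f) ≤ A u}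

/-- Positively one-homogeneous. -/
def PosOneHom {V : Type*} (A : (V → ℝ) → ℝ) : Prop :=
  ∀ ν : ℝ, 0 ≤ ν → ∀ f, A (ν • f) = ν * A f

/-- Positively `p`-homogeneous (real exponent, via `rpow`). -/
noncomputable def PosPHom {V : Type*} (p : ℝ) (A : (V → ℝ) → ℝ) : Prop :=
  ∀ ν : ℝ, 0 ≤ ν → ∀ f, A (ν • f) = ν ^ p * A f

/-- The inner objective `Φ_f^c` of RatioDCA-prox, with `F f = (R₁ f - R₂ f)/(S₁ f - S₂ f)`. -/
noncomputable def Phi {V : Type*} [Fintype V] (R1 R2 S1 S2 : (V → ℝ) → ℝ)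
    (f r2 s1 g : V → ℝ) (c : ℝ) (u : V → ℝ) : ℝ :=
  R1 u - ip u r2 + ((R1 f - R2 f) / (S1 f - S2 f)) * (S2 u - ip u s1) - c * ip u g

theorem aux_ip_sub {V : Type*} [Fintype V] (a u v : V → ℝ) : ip a (u - v) = ip a u - ip a v := by
  simp [ip, mul_sub, Finset.sum_sub_distrib]

theorem aux_ip_smul {V : Type*} [Fintype V] (a u : V → ℝ) (t : ℝ) : ip a (t • u) = t * ip a u := by
  simp only [ip, Finset.mul_sum, Pi.smul_apply, smul_eq_mul]
  exact Finset.sum_congr rfl fun i _ => by ring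

theorem aux_ip_comm {V : Type*} [Fintype V] (a u : V → ℝ) : ip a u = ip u a := by
  simp only [ip, mul_comm]

theorem aux_hom_eq {V : Type*} [Fintype V] {A : (V → ℝ) → ℝ} (hA : PosOneHom A) {f a : V → ℝ}
    (ha : a ∈ subdiff A f) : ip f a = A f := by
  have h0 := ha ((0 : ℝ) • f)
  have h2 := ha ((2 : ℝ) • f)
  rw [hA _ (by norm_num), aux_ip_sub, aux_ip_smul] at h0 h2
  rw [aux_ip_comm f a]
  linarith

theorem aux_hom_le {V : Type*} [Fintype V] {A : (V → ℝ) → ℝ} (hA : PosOneHom A) {f a : V → ℝ}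
    (ha : a ∈ subdiff A f) (u : V → ℝ) : ip u a ≤ A u := by
  have h0 := ha u
  have h := aux_hom_eq hA ha
  rw [aux_ip_sub, aux_ip_comm a f, aux_ip_comm a u] at h0
  linarith

theorem aux_cont {V : Type*} [Fintype V] {A : (V → ℝ) → ℝ} (hA : ConvexOn ℝ Set.univ A) :
    Continuous A := by
  have := hA.continuousOn isOpen_univ
  exact continuousOn_univ.mp this

theorem aux_compact {V : Type*} [Fintype V] {G : (V → ℝ) → ℝ} (hG : ConvexOn ℝ Set.univ G)
    (hGnonneg : ∀ u, 0 ≤ G u) (hGzero : ∀ u, G u = 0 ↔ u = 0) :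
    IsCompact {u | G u = 1} := by
  have hcont := aux_cont hG
  obtain ⟨m, hm, hmG⟩ : ∃ m : ℝ, 0 < m ∧ ∀ x ∈ Metric.sphere (0 : V → ℝ) 1, m ≤ G x := by
    rcases (Metric.sphere (0 : V → ℝ) 1).eq_empty_or_nonempty with he | hne
    · exact ⟨1, one_pos, by simp [he]⟩
    · obtain ⟨x, hx, hmin⟩ := (isCompact_sphere (0 : V → ℝ) 1).exists_isMinOn hne hcont.continuousOn
      refine ⟨G x, lt_of_le_of_ne (hGnonneg x) ?_, fun y hy => hmin hy⟩
      intro h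
      have := (hGzero x).1 h.symm
      simp [this] at hx
  refine Metric.isCompact_of_isClosed_isBounded (isClosed_eq hcont continuous_const) ?_
  refine isBounded_iff_forall_norm_le.2 ⟨max 1 (1 / m), fun x hx => ?_⟩
  have hx : G x = 1 := hx
  rcases le_total ‖x‖ 1 with h | h
  · exact h.trans (le_max_left _ _)
  · refine le_trans ?_ (le_max_right _ _)
    have hpos : 0 < ‖x‖ := by linarith
    have hi : ‖x‖⁻¹ ≤ 1 := inv_le_one_of_one_le₀ h
    have h1 := hG.2 (Set.mem_univ x) (Set.mem_univ 0) (inv_nonneg.2 hpos.le)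
      (sub_nonneg.2 hi) (by ring)
    rw [(hGzero 0).2 rfl, hx] at h1
    have h2 := hmG (‖x‖⁻¹ • x) (by
      simp [norm_smul, hpos.ne'])
    simp only [smul_zero, add_zero, smul_eq_mul, mul_one, mul_zero] at h1
    have h3 := h2.trans h1
    rw [le_div_iff₀ hm]
    calc ‖x‖ * m ≤ ‖x‖ * ‖x‖⁻¹ := by gcongr
      _ = 1 := mul_inv_cancel₀ hpos.ne'

theorem aux_nrm_cont {V : Type*} [Fintype V] : Continuous (nrm : (V → ℝ) → ℝ) := by
  unfold nrm
  fun_prop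

theorem aux_unif {V : Type*} [Fintype V] {G : (V → ℝ) → ℝ} (hG : StrictConvexOn ℝ Set.univ G)
    (hK : IsCompact {u | G u = 1}) {ε : ℝ} (hε : 0 < ε) :
    ∃ η : ℝ, 0 < η ∧ ∀ x y, G x = 1 → G y = 1 → ε ≤ nrm (y - x) →
      G ((1 / 2 : ℝ) • x + (1 / 2 : ℝ) • y) ≤ 1 - η := by
  have hcont := aux_cont hG.convexOn
  let T : Set ((V → ℝ) × (V → ℝ)) :=
    ({u | G u = 1} ×ˢ {u | G u = 1}) ∩ {q | ε ≤ nrm (q.2 - q.1)}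
  have hT : IsCompact T := (hK.prod hK).inter_right
    (isClosed_le continuous_const (aux_nrm_cont.comp (by fun_prop)))
  rcases T.eq_empty_or_nonempty with he | hne
  · refine ⟨1, one_pos, fun x y hx hy h => ?_⟩
    have : (x, y) ∈ T := ⟨⟨hx, hy⟩, h⟩
    simp [he] at this
  · have hc : Continuous fun q : (V → ℝ) × (V → ℝ) =>
        G ((1 / 2 : ℝ) • q.1 + (1 / 2 : ℝ) • q.2) := hcont.comp (by fun_prop)
    obtain ⟨⟨a, b⟩, ⟨⟨ha, hb⟩, hab⟩, hmax⟩ := hT.exists_isMaxOn hne hc.continuousOn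
    refine ⟨1 - G ((1 / 2 : ℝ) • a + (1 / 2 : ℝ) • b), ?_, fun x y hx hy h => ?_⟩
    · have hne : a ≠ b := by
        rintro rfl
        simp [nrm] at hab
        linarith
      have := hG.2 (Set.mem_univ a) (Set.mem_univ b) hne (show (0 : ℝ) < 1 / 2 by norm_num)
        (show (0 : ℝ) < 1 / 2 by norm_num) (by norm_num)
      have ha : G a = 1 := ha
      have hb : G b = 1 := hb
      rw [ha, hb] at this
      norm_num at this ⊢
      linarith
    · have : (x, y) ∈ T := ⟨⟨hx, hy⟩, h⟩
      have := hmax this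
      simp only [Set.mem_ofPred_eq] at this
      linarith

/-- if `G` is strictly convex and `c^k ≥ γ > 0` for all `k`, then
successive RatioDCA-prox iterates satisfy `‖f^{k+1} − f^k‖₂ → 0`. -/
theorem ratioDCA_prox_successive_iterates_converge {V : Type*} [Fintype V]
    (p : ℝ) (hp : 1 ≤ p)
    (R1 R2 S1 S2 G : (V → ℝ) → ℝ)
    (hR1conv : ConvexOn ℝ Set.univ R1) (hR2conv : ConvexOn ℝ Set.univ R2)
    (hS1conv : ConvexOn ℝ Set.univ S1) (hS2conv : ConvexOn ℝ Set.univ S2)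
    (hR1hom : PosOneHom R1) (hR2hom : PosOneHom R2)
    (hS1hom : PosOneHom S1) (hS2hom : PosOneHom S2)
    (hRnonneg : ∀ u, 0 ≤ R1 u - R2 u) (hSnonneg : ∀ u, 0 ≤ S1 u - S2 u)
    (hGconv : ConvexOn ℝ Set.univ G) (hGstrict : StrictConvexOn ℝ Set.univ G)
    (hGnonneg : ∀ u, 0 ≤ G u)
    (hGhom : PosPHom p G) (hGzero : ∀ u, G u = 0 ↔ u = 0)
    (f : ℕ → V → ℝ) (c : ℕ → ℝ) (γ : ℝ) (hγ : 0 < γ) (hc : ∀ k, γ ≤ c k)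
    (hGf : ∀ k, G (f k) = 1) (hSf : ∀ k, S1 (f k) - S2 (f k) ≠ 0)
    (r2 s1 g : ℕ → V → ℝ)
    (hr2 : ∀ k, r2 k ∈ subdiff R2 (f k))
    (hs1 : ∀ k, s1 k ∈ subdiff S1 (f k))
    (hg : ∀ k, g k ∈ subdiff G (f k))
    (hmin : ∀ k, ∀ u, G u ≤ 1 →
      Phi R1 R2 S1 S2 (f k) (r2 k) (s1 k) (g k) (c k) (f (k + 1)) ≤
        Phi R1 R2 S1 S2 (f k) (r2 k) (s1 k) (g k) (c k) u)
    (hdec : ∀ k,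
      Phi R1 R2 S1 S2 (f k) (r2 k) (s1 k) (g k) (c k) (f (k + 1)) <
        Phi R1 R2 S1 S2 (f k) (r2 k) (s1 k) (g k) (c k) (f k)) :
    Tendsto (fun k => nrm (f (k + 1) - f k)) atTop (nhds 0) := by
  have hK := aux_compact hGconv hGnonneg hGzero
  obtain ⟨M, hM⟩ := hK.exists_bound_of_continuousOn
    (f := fun u => S1 u - S2 u) ((aux_cont hS1conv).sub (aux_cont hS2conv)).continuousOn
  have hSpos : ∀ k, 0 < S1 (f k) - S2 (f k) := fun k =>
    lt_of_le_of_ne (hSnonneg _) (hSf k).symm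
  have hSM : ∀ k, S1 (f k) - S2 (f k) ≤ M := fun k =>
    (le_abs_self _).trans (hM (f k) (hGf k))
  set F : ℕ → ℝ := fun k => (R1 (f k) - R2 (f k)) / (S1 (f k) - S2 (f k)) with hF
  have hF0 : ∀ k, 0 ≤ F k := fun k => div_nonneg (hRnonneg _) (hSnonneg _)
  have hFS : ∀ k, F k * (S1 (f k) - S2 (f k)) = R1 (f k) - R2 (f k) := fun k =>
    div_mul_cancel₀ _ (hSf k)
  have hMpos : 0 < M := (hSpos 0).trans_le (hSM 0)
  let δ : ℕ → ℝ := fun k => ip (g k) (f k) - ip (g k) (f (k + 1))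
  have hδ0 : ∀ k, 0 ≤ δ k := fun k => by
    have := hg k (f (k + 1))
    rw [aux_ip_sub, hGf, hGf] at this
    simp only [δ]
    linarith
  have hkey : ∀ k, c k * δ k ≤ (S1 (f (k + 1)) - S2 (f (k + 1))) * (F k - F (k + 1)) := fun k => by
    have h := (hdec k).le
    simp only [Phi] at h
    change _ + F k * _ - _ ≤ _ + F k * _ - _ at h
    rw [aux_hom_eq hR2hom (hr2 k), aux_hom_eq hS1hom (hs1 k), aux_ip_comm _ (g k),
      aux_ip_comm _ (g k)] at h
    have h1 := aux_hom_le hR2hom (hr2 k) (f (k + 1))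
    have h2 := mul_le_mul_of_nonneg_left (aux_hom_le hS1hom (hs1 k) (f (k + 1))) (hF0 k)
    have h3 := hFS k
    have h4 := hFS (k + 1)
    simp only [δ]
    linarith
  have hanti : Antitone F := antitone_nat_of_succ_le fun k => by
    have h1 : 0 ≤ c k * δ k := mul_nonneg (hγ.le.trans (hc k)) (hδ0 k)
    have h2 := h1.trans (hkey k)
    have := nonneg_of_mul_nonneg_right h2 (hSpos (k + 1))
    linarith
  have hbd : ∀ k, δ k ≤ M / γ * (F k - F (k + 1)) := fun k => by
    have h1 : γ * δ k ≤ c k * δ k := mul_le_mul_of_nonneg_right (hc k) (hδ0 k)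
    have h2 : 0 ≤ F k - F (k + 1) := sub_nonneg.2 (hanti (Nat.le_succ k))
    have h3 := mul_le_mul_of_nonneg_right (hSM (k + 1)) h2
    have h4 := hkey k
    rw [div_mul_eq_mul_div, le_div_iff₀ hγ]
    linarith
  have hlim := tendsto_atTop_ciInf hanti ⟨0, by rintro _ ⟨k, rfl⟩; exact hF0 k⟩
  have hdiff : Tendsto (fun k => M / γ * (F k - F (k + 1))) atTop (nhds 0) := by
    have := (hlim.sub (hlim.comp (tendsto_add_atTop_nat 1))).const_mul (M / γ)
    simpa using this
  have hδ : Tendsto δ atTop (nhds 0) := squeeze_zero hδ0 hbd hdiff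
  rw [Metric.tendsto_atTop]
  intro ε hε
  obtain ⟨η, hη, hu⟩ := aux_unif hGstrict hK hε
  obtain ⟨N, hN⟩ := Filter.eventually_atTop.1 (hδ.eventually (gt_mem_nhds hη))
  refine ⟨N, fun k hk => ?_⟩
  rw [Real.dist_0_eq_abs, abs_of_nonneg (show 0 ≤ nrm (f (k + 1) - f k) from Real.sqrt_nonneg _)]
  by_contra hcon
  have h1 := hu _ _ (hGf k) (hGf (k + 1)) (not_lt.1 hcon)
  have h2 := hg k ((1 / 2 : ℝ) • f k + (1 / 2 : ℝ) • f (k + 1))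
  have h3 : (1 / 2 : ℝ) • f k + (1 / 2 : ℝ) • f (k + 1) - f k
      = (1 / 2 : ℝ) • (f (k + 1) - f k) := by
    ext i
    simp
    ring
  rw [h3, aux_ip_smul, aux_ip_sub, hGf] at h2
  have h4 : δ k < η := hN k hk
  simp only [δ] at h4
  linarith
end

section
/- Let f ∈ ℝ^V with G(f) = 1 and S(f) ≠ 0, let c ≥ 0, and fix subgradients r₂ ∈ ∂R₂(f), s₁ ∈ ∂S₁(f), g ∈ ∂G(f). Then every h ∈ ℝ^V with S(h) = 0 and G(h) ≤ 1 satisfies Φ_f^c(h) ≥ Φ_f^c(f). Consequently, if f⁺ minimizes Φ_f^c over {u : G(u) ≤ 1} and Φ_f^c(f⁺) < Φ_f^c(f), then S(f⁺) ≠ 0. -/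
open Finset Filter

theorem ip_symm {V : Type*} [Fintype V] (a b : V → ℝ) : ip a b = ip b a := by
  simp [ip, mul_comm]

theorem ip_sub_right {V : Type*} [Fintype V] (a b d : V → ℝ) :
    ip a (b - d) = ip a b - ip a d := by
  simp [ip, mul_sub, Finset.sum_sub_distrib]

theorem ip_smul_right {V : Type*} [Fintype V] (t : ℝ) (a b : V → ℝ) :
    ip a (t • b) = t * ip a b := by
  simp [ip, Finset.mul_sum, mul_left_comm]

/-- Euler identity and support inequality for one-homogeneous functions. -/
theorem subdiff_hom {V : Type*} [Fintype V] {A : (V → ℝ) → ℝ} (hA : PosOneHom A)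
    {f a : V → ℝ} (ha : a ∈ subdiff A f) : ip a f = A f ∧ ∀ u, ip a u ≤ A u := by
  have h0 := ha ((0 : ℝ) • f)
  have h2 := ha ((2 : ℝ) • f)
  rw [hA _ (by norm_num), ip_sub_right, ip_smul_right] at h0 h2
  have e : ip a f = A f := by linarith
  refine ⟨e, fun u => ?_⟩
  have hu := ha u
  rw [ip_sub_right] at hu
  linarith

/-- any `h` with `S h = 0` and `G h ≤ 1` satisfies `Φ_f^c(h) ≥ Φ_f^c(f)`;
consequently a strictly improving minimizer `f⁺` has `S(f⁺) ≠ 0`. -/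
theorem ratioDCA_prox_avoids_degenerate_points {V : Type*} [Fintype V] (p : ℝ) (hp : 1 ≤ p)
    (R1 R2 S1 S2 G : (V → ℝ) → ℝ)
    (hR1conv : ConvexOn ℝ Set.univ R1) (hR2conv : ConvexOn ℝ Set.univ R2)
    (hS1conv : ConvexOn ℝ Set.univ S1) (hS2conv : ConvexOn ℝ Set.univ S2)
    (hR1hom : PosOneHom R1) (hR2hom : PosOneHom R2)
    (hS1hom : PosOneHom S1) (hS2hom : PosOneHom S2)
    (hRnonneg : ∀ u, 0 ≤ R1 u - R2 u) (hSnonneg : ∀ u, 0 ≤ S1 u - S2 u)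
    (hGconv : ConvexOn ℝ Set.univ G) (hGnonneg : ∀ u, 0 ≤ G u)
    (hGhom : PosPHom p G) (hGzero : ∀ u, G u = 0 ↔ u = 0)
    (f : V → ℝ) (hGf : G f = 1) (hSf : S1 f - S2 f ≠ 0)
    (c : ℝ) (hc : 0 ≤ c)
    (r2 : V → ℝ) (hr2 : r2 ∈ subdiff R2 f)
    (s1 : V → ℝ) (hs1 : s1 ∈ subdiff S1 f)
    (g : V → ℝ) (hg : g ∈ subdiff G f) :
    (∀ h : V → ℝ, S1 h - S2 h = 0 → G h ≤ 1 →
      Phi R1 R2 S1 S2 f r2 s1 g c f ≤ Phi R1 R2 S1 S2 f r2 s1 g c h) ∧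
    (∀ fplus : V → ℝ, G fplus ≤ 1 →
      (∀ u, G u ≤ 1 →
        Phi R1 R2 S1 S2 f r2 s1 g c fplus ≤ Phi R1 R2 S1 S2 f r2 s1 g c u) →
      Phi R1 R2 S1 S2 f r2 s1 g c fplus < Phi R1 R2 S1 S2 f r2 s1 g c f →
      S1 fplus - S2 fplus ≠ 0) := by
  have F0 : 0 ≤ (R1 f - R2 f) / (S1 f - S2 f) := div_nonneg (hRnonneg f) (hSnonneg f)
  obtain ⟨r_f, r_h⟩ := subdiff_hom hR2hom hr2
  obtain ⟨s_f, s_h⟩ := subdiff_hom hS1hom hs1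
  have key : ∀ h : V → ℝ, S1 h - S2 h = 0 → G h ≤ 1 →
      Phi R1 R2 S1 S2 f r2 s1 g c f ≤ Phi R1 R2 S1 S2 f r2 s1 g c h := by
    intro h hS hG
    have hgh := hg h
    rw [ip_sub_right] at hgh
    have h1 : ip h g ≤ ip f g := by
      rw [ip_symm h, ip_symm f]; linarith
    have h2 := mul_le_mul_of_nonneg_left h1 hc
    have h3 : 0 ≤ (R1 f - R2 f) / (S1 f - S2 f) * (S2 h - ip h s1) :=
      mul_nonneg F0 (by have := s_h h; rw [ip_symm h]; linarith)
    have h4 : (R1 f - R2 f) / (S1 f - S2 f) * (S2 f - ip f s1) = -(R1 f - R2 f) := by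
      rw [ip_symm f, s_f]; field_simp; ring
    have h5 := r_h h
    have h6 := hRnonneg h
    unfold Phi
    rw [h4, ip_symm f r2, r_f, ip_symm h r2]
    linarith
  refine ⟨key, ?_⟩
  intro fplus hG _ hlt hS
  exact absurd (key fplus hS hG) (not_le.mpr hlt)
end
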